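/- arXiv:math/0005273 — 2 statements merged into one kernel-verified Lean document; each statement's English description precedes it below -/
import Mathlib

section
/- Let λ be an infinite cardinal and let C be a clone on λ containing all unary functions. Suppose C contains a binary function H depending heavily on both of its coordinates, and C contains a binary function F that is canonical on λ (i.e., on ∇Δ_λ) and whose restriction to Δ_λ = {(α,β) : α > β} is injective. Then C = O(λ). -/
open Cardinal Set

universe u v

abbrev Operation (X : Type u) : Type u := Σ n : ℕ, ((Fin (n + 1) → X) → X)

def IsClone {X : Type u} (C : Set (Operation X)) : Prop :=
  (∀ (n : ℕ) (k : Fin (n + 1)), (⟨n, fun x => x k⟩ : Operation X) ∈ C) ∧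
  (∀ (n m : ℕ) (g : (Fin (m + 1) → X) → X) (f : Fin (m + 1) → (Fin (n + 1) → X) → X),
    (⟨m, g⟩ : Operation X) ∈ C → (∀ i, (⟨n, f i⟩ : Operation X) ∈ C) →
    (⟨n, fun x => g fun i => f i x⟩ : Operation X) ∈ C)

def unaryOp {X : Type u} (f : X → X) : Operation X := ⟨0, fun x => f (x 0)⟩

def binOp {X : Type u} (g : X → X → X) : Operation X := ⟨1, fun x => g (x 0) (x 1)⟩

def PrecompleteClone {X : Type u} (C : Set (Operation X)) : Prop :=
  IsClone C ∧ C ≠ Set.univ ∧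
    ∀ D : Set (Operation X), IsClone D → C ⊆ D → D = C ∨ D = Set.univ

def cloneGen {X : Type u} (F : Set (Operation X)) : Set (Operation X) :=
  ⋂₀ {C : Set (Operation X) | IsClone C ∧ F ⊆ C}

def cl {X : Type u} (F : Set (Operation X)) : Set (Operation X) :=
  ⋂₀ {C : Set (Operation X) | IsClone C ∧ F ⊆ C ∧ ∀ f : X → X, unaryOp f ∈ C}

def Pol {X : Type u} {I : Type v} (R : Set (I → X)) : Set (Operation X) :=
  {op | ∀ ρ : Fin (op.1 + 1) → (I → X), (∀ j, ρ j ∈ R) →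
    (fun i => op.2 fun j => ρ j i) ∈ R}

def IsPairing {X : Type u} (f : X → X → X) : Prop :=
  ∀ ⦃x y x' y' : X⦄, x ≠ y → x' ≠ y' → f x y = f x' y' → x = x' ∧ y = y'

def almostUnary2 {X : Type u} (g : X × X → X) : Prop :=
  ∃ G : X → Set X, (∀ x : X, #↥(G x) < #X) ∧
    ((∀ p : X × X, g p ∈ G p.1) ∨ (∀ p : X × X, g p ∈ G p.2))

def AU2 (X : Type u) : Set (X × X → X) := {g | almostUnary2 g}

def HeavilyBinary {X : Type u} (C : Set (Operation X)) : Prop :=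
  ∃ H : X → X → X, binOp H ∈ C ∧
    (∃ b : X, #↥(Set.range fun x => H x b) = #X) ∧
    (∃ a : X, #↥(Set.range fun y => H a y) = #X)

def IsCanonicalOn {X : Type u} [LinearOrder X] (F : X → X → X) (S : Set X) : Prop :=
  ∀ a b : Fin 4 → X, (∀ i, a i ∈ S) → (∀ i, b i ∈ S) →
    (∀ i j, a i < a j ↔ b i < b j) → a 0 ≠ a 1 → a 2 ≠ a 3 →
    (F (a 0) (a 1) < F (a 2) (a 3) → F (b 0) (b 1) < F (b 2) (b 3))

def PrColoring {X : Type u} {M : Type v} [LinearOrder X] (c : X → X → M) : Prop :=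
  (∀ x y : X, c x y = c y x) ∧
  ∀ a : X → Finset X, (∀ i j : X, i ≠ j → Disjoint (a i) (a j)) →
    ∀ c₀ : M, ∃ i j : X, i < j ∧ ∀ x ∈ a i, ∀ y ∈ a j, c x y = c₀

open Classical in
noncomputable def FA {X : Type u} {M : Type v} [LinearOrder X]
    (c : X → X → M) (pr : X → X → X) (z : X) (A : Set M) (α β : X) : X :=
  if α = z ∨ β = z ∨ α = β then max α β
  else if c α β ∈ A then pr α β else z

section Clones

variable {X : Type u} {C : Set (Operation X)}

theorem IsClone.comp_unaryOp_mem (hC : IsClone C) {n : ℕ} {g : X → X}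
    {p : (Fin (n + 1) → X) → X} (hg : unaryOp g ∈ C) (hp : (⟨n, p⟩ : Operation X) ∈ C) :
    (⟨n, fun x => g (p x)⟩ : Operation X) ∈ C :=
  hC.2 n 0 _ (fun _ => p) hg fun _ => hp

theorem IsClone.comp_binOp_mem (hC : IsClone C) {n : ℕ} {g : X → X → X}
    {p q : (Fin (n + 1) → X) → X} (hg : binOp g ∈ C) (hp : (⟨n, p⟩ : Operation X) ∈ C)
    (hq : (⟨n, q⟩ : Operation X) ∈ C) :
    (⟨n, fun x => g (p x) (q x)⟩ : Operation X) ∈ C := by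
  refine hC.2 n 1 _ ![p, q] hg fun i => ?_
  fin_cases i
  · exact hp
  · exact hq

/-- A clone containing all unary functions and an injective binary function contains injective
functions of every arity. -/
theorem IsClone.exists_injective_mem (hC : IsClone C) {J : X → X → X} (hJC : binOp J ∈ C)
    (hJ : Function.Injective2 J) (n : ℕ) :
    ∃ p : (Fin (n + 1) → X) → X, Function.Injective p ∧ (⟨n, p⟩ : Operation X) ∈ C := by
  induction n with
  | zero =>
    refine ⟨fun x => x 0, fun x y h => ?_, hC.1 0 0⟩
    funext i
    rwa [Fin.fin_one_eq_zero i]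
  | succ n ih =>
    obtain ⟨p, hp, hpC⟩ := ih
    refine ⟨fun x => J (p fun i => x i.castSucc) (x (Fin.last (n + 1))), fun x y h => ?_, ?_⟩
    · obtain ⟨h1, h2⟩ := hJ h
      funext i
      refine Fin.lastCases h2 (fun j => congrFun (hp h1) j) i
    · exact hC.comp_binOp_mem hJC
        (hC.2 (n + 1) n p (fun i x => x i.castSucc) hpC fun i => hC.1 _ _) (hC.1 _ _)

theorem IsClone.eq_univ_of_injective2 [Nonempty X] (hC : IsClone C)
    (hU : ∀ f : X → X, unaryOp f ∈ C)
    {J : X → X → X} (hJC : binOp J ∈ C) (hJ : Function.Injective2 J) : C = Set.univ := by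
  refine Set.eq_univ_of_forall fun ⟨n, f⟩ => ?_
  obtain ⟨p, hp, hpC⟩ := hC.exists_injective_mem hJC hJ n
  have h := hC.comp_unaryOp_mem (hU fun z => f (Function.invFun p z)) hpC
  simpa only [Function.leftInverse_invFun hp _] using h

/-- On an infinite set it suffices that a binary function separates pairs off the diagonal. -/
theorem IsClone.eq_univ_of_isPairing [Infinite X] (hC : IsClone C)
    (hU : ∀ f : X → X, unaryOp f ∈ C)
    {G : X → X → X} (hGC : binOp G ∈ C) (hG : IsPairing G) : C = Set.univ := by
  obtain ⟨e⟩ : Nonempty (X ⊕ X ≃ X) := Cardinal.eq.1 (by simp)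
  refine hC.eq_univ_of_injective2 hU (J := fun x y => G (e (.inl x)) (e (.inr y)))
    (hC.comp_binOp_mem hGC (hC.comp_unaryOp_mem (hU fun x => e (.inl x)) (hC.1 1 0))
      (hC.comp_unaryOp_mem (hU fun x => e (.inr x)) (hC.1 1 1))) fun x x' y y' h => ?_
  simpa using hG (by simp) (by simp) h

end Clones

section Cardinality

variable {X : Type u} [Infinite X]

theorem exists_injective_disjoint_ranges {R S : Set X} (hR : #R = #X) (hS : #S = #X) :
    ∃ r s : X → X, Function.Injective r ∧ Function.Injective s ∧ (∀ x, r x ∈ R) ∧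
      (∀ x, s x ∈ S) ∧ ∀ x y, r x ≠ s y := by
  obtain ⟨e⟩ : Nonempty (X ⊕ X ≃ R) := Cardinal.eq.1 (by simp [hR])
  set A : Set X := Set.range fun x => (e (.inl x) : X) with hA
  have hl : Function.Injective fun x => (e (.inl x) : X) := fun x y h => by
    simpa using Subtype.ext h
  have hr : Function.Injective fun x => (e (.inr x) : X) := fun x y h => by
    simpa using Subtype.ext h
  by_cases h : #X ≤ #↥(S \ A)
  · obtain ⟨s⟩ := h
    refine ⟨_, fun x => s x, hl, Subtype.val_injective.comp s.injective, fun x => (e _).2,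
      fun x => (s x).2.1, fun x y hxy => (s y).2.2 ⟨x, hxy⟩⟩
  · have h' : #X ≤ #↥(S ∩ A) := by
      by_contra h'
      have := Cardinal.add_lt_of_lt (Cardinal.aleph0_le_mk X) (not_le.1 h) (not_le.1 h')
      refine this.not_ge (hS.symm.le.trans ?_)
      calc #S = #↥(S \ A ∪ S ∩ A) := by rw [Set.sdiff_union_inter]
        _ ≤ _ := Cardinal.mk_union_le _ _
    obtain ⟨s⟩ := h'
    refine ⟨_, fun x => s x, hr, Subtype.val_injective.comp s.injective, fun x => (e _).2,
      fun x => (s x).2.1, fun x y hxy => ?_⟩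
    obtain ⟨z, hz⟩ := (s y).2.2
    simpa using Subtype.ext (hz.trans hxy.symm)

end Cardinality

section Canonical

variable {X : Type u} [LinearOrder X]

theorem exists_strictMono_nat [WellFoundedLT X] [Infinite X] :
    ∃ e : ℕ → X, StrictMono e := by
  obtain ⟨g, hg | hg⟩ := exists_increasing_or_nonincreasing_subseq (· < ·) (Infinite.natEmbedding X)
  · exact ⟨_, fun m n h => hg m n h⟩
  · have hanti : StrictAnti fun n => Infinite.natEmbedding X (g n) := fun m n h =>
      lt_of_le_of_ne (not_lt.1 (hg m n h)) fun he => by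
        have := g.injective ((Infinite.natEmbedding X).injective he)
        omega
    exact (not_strictAnti_of_wellFoundedLT _ hanti).elim

/-- A finite tuple can be realised twice up to order isomorphism, the two copies differing
exactly at a given entry that is distinct from all others. -/
theorem exists_two_copies [WellFoundedLT X] [Infinite X] {k : ℕ} (a : Fin k → X) (i : Fin k)
    (hi : ∀ j, j ≠ i → a i ≠ a j) :
    ∃ b c : Fin k → X, (∀ j l, a j < a l ↔ b j < b l) ∧ (∀ j l, a j < a l ↔ c j < c l) ∧
      (∀ j, j ≠ i → b j = c j) ∧ b i ≠ c i := by
  obtain ⟨e, he⟩ := exists_strictMono_nat (X := X)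
  let r : Fin k → ℕ := fun j => (Finset.univ.filter fun l => a l < a j).card
  have hle : ∀ j l, a j ≤ a l → r j ≤ r l := fun j l h =>
    Finset.card_le_card fun m hm => by
      simp only [Finset.mem_filter, Finset.mem_univ, true_and] at hm ⊢
      exact hm.trans_le h
  have hlt : ∀ j l, a j < a l → r j < r l := fun j l h => by
    refine Finset.card_lt_card ⟨fun m hm => ?_, fun hs => ?_⟩
    · simp only [Finset.mem_filter, Finset.mem_univ, true_and] at hm ⊢
      exact hm.trans h
    · have := hs (by simpa using h : j ∈ Finset.univ.filter fun m => a m < a l)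
      simp at this
  refine ⟨fun j => e (2 * r j), fun j => e (2 * r j + if j = i then 1 else 0), fun j l => ?_,
    fun j l => ?_, fun j hj => by simp [hj], fun h => by simpa using he.injective h⟩
  · rw [he.lt_iff_lt]
    refine ⟨fun h => by have := hlt j l h; omega, fun h => not_le.1 fun h' => ?_⟩
    have := hle l j h'
    omega
  · rw [he.lt_iff_lt]
    refine ⟨fun h => by have := hlt j l h; split_ifs <;> omega, fun h => not_le.1 fun h' => ?_⟩
    rcases h'.eq_or_lt with h' | h'
    · have hj : j = l := by
        by_contra hne
        by_cases hji : j = i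
        · exact hi l (fun h => hne (hji.trans h.symm)) (hji ▸ h'.symm)
        · by_cases hli : l = i
          · exact hi j hji (hli ▸ h')
          · have := hle l j h'.le
            simp [hji, hli] at h
            omega
      simp [hj] at h
    · have := hlt l j h'
      split_ifs at h <;> omega

variable {F : X → X → X}

theorem IsCanonicalOn.eq_of_eq (hF : IsCanonicalOn F Set.univ) {a b : Fin 4 → X}
    (hab : ∀ i j, a i < a j ↔ b i < b j) (h01 : a 0 ≠ a 1) (h23 : a 2 ≠ a 3)
    (h : F (a 0) (a 1) = F (a 2) (a 3)) : F (b 0) (b 1) = F (b 2) (b 3) := by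
  have hne : ∀ i j, a i ≠ a j → b i ≠ b j := fun i j hij => by
    rcases lt_or_gt_of_ne hij with h | h
    · exact ((hab _ _).1 h).ne
    · exact ((hab _ _).1 h).ne'
  refine le_antisymm (not_lt.1 fun hlt => ?_) (not_lt.1 fun hlt => ?_)
  · exact (hF ![b 2, b 3, b 0, b 1] ![a 2, a 3, a 0, a 1] (by simp) (by simp)
      (fun i j => by fin_cases i <;> fin_cases j <;> simp [hab])
      (hne _ _ h23) (hne _ _ h01) hlt).ne h.symm
  · exact (hF b a (by simp) (by simp) (fun i j => (hab i j).symm)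
      (hne _ _ h01) (hne _ _ h23) hlt).ne h

variable [WellFoundedLT X] [Infinite X]

/-- If a canonical function injective below the diagonal takes a common value below and above
the diagonal, then it does so at mirror-image pairs. -/
theorem IsCanonicalOn.mirror_of_eq (hF : IsCanonicalOn F Set.univ)
    (hinj : Set.InjOn (fun p : X × X => F p.1 p.2) {p : X × X | p.2 < p.1})
    {x y z w : X} (hxy : y < x) (hzw : z < w) (h : F x y = F z w) : x = w ∧ y = z := by
  have key : ∀ i : Fin 4, i = 0 ∨ i = 1 →
      ¬ ∀ j, j ≠ i → ![x, y, z, w] i ≠ ![x, y, z, w] j := by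
    intro i hi hne
    obtain ⟨b, c, hb, hc, hbc, hbci⟩ := exists_two_copies _ i hne
    have h1 := hF.eq_of_eq hb hxy.ne' hzw.ne h
    have h2 := hF.eq_of_eq hc hxy.ne' hzw.ne h
    rw [hbc 2 (by rintro rfl; simp at hi), hbc 3 (by rintro rfl; simp at hi), ← h2] at h1
    have := hinj (x₁ := (b 0, b 1)) (x₂ := (c 0, c 1)) ((hb 1 0).1 hxy) ((hc 1 0).1 hxy) h1
    simp only [Prod.mk.injEq] at this
    rcases hi with rfl | rfl
    · exact hbci this.1
    · exact hbci this.2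
  have k0 := key 0 (.inl rfl)
  have k1 := key 1 (.inr rfl)
  simp [Fin.forall_fin_succ] at k0 k1
  by_cases hxz : x = z
  · subst hxz
    exact absurd (k1 hxy.ne hxy.ne) (hxy.trans hzw).ne
  · obtain rfl := k0 hxy.ne' hxz
    by_contra hne
    exact hxy.ne (k1 hxy.ne fun hyz => hne ⟨rfl, hyz⟩)

theorem IsCanonicalOn.symm_or_disjoint (hF : IsCanonicalOn F Set.univ)
    (hinj : Set.InjOn (fun p : X × X => F p.1 p.2) {p : X × X | p.2 < p.1}) :
    (∀ x y, y < x → F x y = F y x) ∨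
      ∀ x y z w, y < x → z < w → F x y ≠ F z w := by
  by_contra! hcon
  obtain ⟨⟨x', y', hxy', hne⟩, x, y, z, w, hxy, hzw, h⟩ := hcon
  obtain ⟨rfl, rfl⟩ := hF.mirror_of_eq hinj hxy hzw h
  refine hne (hF.eq_of_eq (a := ![x, y, y, x]) (b := ![x', y', y', x']) (fun i j => ?_)
    hxy.ne' hxy.ne h)
  fin_cases i <;> fin_cases j <;> simp [hxy, hxy', hxy.not_gt, hxy'.not_gt]

end Canonical

theorem stmt17 {X : Type u} [LinearOrder X] [WellFoundedLT X] [Infinite X]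
    (hsmall : ∀ x : X, #{y : X | y < x} < #X)
    (C : Set (Operation X)) (hC : IsClone C)
    (hU : ∀ f : X → X, unaryOp f ∈ C)
    (H : X → X → X) (hHC : binOp H ∈ C)
    (hH1 : ∃ b : X, #↥(Set.range fun x => H x b) = #X)
    (hH2 : ∃ a : X, #↥(Set.range fun y => H a y) = #X)
    (F : X → X → X) (hFC : binOp F ∈ C)
    (hcanon : IsCanonicalOn F Set.univ)
    (hinj : Set.InjOn (fun p : X × X => F p.1 p.2) {p : X × X | p.2 < p.1}) :
    C = Set.univ := by
  have lt_eq : ∀ {x y x' y' : X}, y < x → y' < x' → F x y = F x' y' → x = x' ∧ y = y' :=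
    fun {x y x' y'} h h' e => by
      simpa using hinj (x₁ := (x, y)) (x₂ := (x', y')) h h' e
  rcases hcanon.symm_or_disjoint hinj with hsymm | hdisj
  · obtain ⟨e⟩ : Nonempty (X ⊕ X ≃ X) := Cardinal.eq.1 (by simp)
    refine hC.eq_univ_of_injective2 hU (J := fun x y => F (e (.inl x)) (e (.inr y)))
      (hC.comp_binOp_mem hFC (hC.comp_unaryOp_mem (hU fun x => e (.inl x)) (hC.1 1 0))
        (hC.comp_unaryOp_mem (hU fun x => e (.inr x)) (hC.1 1 1))) fun x x' y y' h => ?_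
    dsimp only at h
    have hne : ∀ u v, e (.inl u) ≠ e (.inr v) := by simp
    rcases lt_or_gt_of_ne (hne x y) with h1 | h1 <;>
      rcases lt_or_gt_of_ne (hne x' y') with h2 | h2
    · rw [← hsymm _ _ h1, ← hsymm _ _ h2] at h
      simpa [and_comm] using lt_eq h1 h2 h
    · rw [← hsymm _ _ h1] at h
      simpa using lt_eq h1 h2 h
    · rw [← hsymm _ _ h2] at h
      simpa using lt_eq h1 h2 h
    · simpa using lt_eq h1 h2 h
  · obtain ⟨b, hb⟩ := hH1
    obtain ⟨a, ha⟩ := hH2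
    obtain ⟨r, s, hr, hs, hrR, hsS, hrs⟩ := exists_injective_disjoint_ranges hb ha
    choose p hp using hrR
    choose q hq using hsS
    dsimp only at hp hq
    classical
    let f : X → X := fun z => if ∃ x y, y < x ∧ F x y = z then p z else a
    let g : X → X := fun z => if ∃ x y, y < x ∧ F x y = z then q z else b
    have hgt : ∀ x y, y < x → H (f (F x y)) (g (F y x)) = r (F x y) := fun x y h => by
      have hf : f (F x y) = p (F x y) := if_pos ⟨x, y, h, rfl⟩
      have hg : g (F y x) = b := if_neg fun ⟨u, v, huv, e⟩ => hdisj u v y x huv h e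
      rw [hf, hg, hp]
    have hlt : ∀ x y, x < y → H (f (F x y)) (g (F y x)) = s (F y x) := fun x y h => by
      have hf : f (F x y) = a := if_neg fun ⟨u, v, huv, e⟩ => hdisj u v x y huv h e
      have hg : g (F y x) = q (F y x) := if_pos ⟨y, x, h, rfl⟩
      rw [hf, hg, hq]
    refine hC.eq_univ_of_isPairing hU (G := fun x y => H (f (F x y)) (g (F y x)))
      (hC.comp_binOp_mem hHC
        (hC.comp_unaryOp_mem (hU f) (hC.comp_binOp_mem hFC (hC.1 1 0) (hC.1 1 1)))
        (hC.comp_unaryOp_mem (hU g) (hC.comp_binOp_mem hFC (hC.1 1 1) (hC.1 1 0))))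
      fun x y x' y' h h' e => ?_
    dsimp only at e
    rcases lt_or_gt_of_ne h with h1 | h1 <;> rcases lt_or_gt_of_ne h' with h2 | h2
    · rw [hlt _ _ h1, hlt _ _ h2] at e
      exact (lt_eq h1 h2 (hs e)).symm
    · rw [hlt _ _ h1, hgt _ _ h2] at e
      exact (hrs _ _ e.symm).elim
    · rw [hgt _ _ h1, hlt _ _ h2] at e
      exact (hrs _ _ e).elim
    · rw [hgt _ _ h1, hgt _ _ h2] at e
      exact lt_eq h1 h2 (hr e)
end

section
/- Let λ be an infinite cardinal satisfying λ → (λ)^2_2. Then for every function F : ∇Δ_λ → λ and every S ⊆ λ with |S| = λ, there exists S' ⊆ S with |S'| = λ such that F is canonical on S'. -/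
open Cardinal Set

universe u v

section CanonicalRamsey

/-- Every colouring of the pairs of `X` by two colours is homogeneous along some strictly
increasing self-map of `X`. -/
def PairHomogeneous (X : Type u) [LinearOrder X] : Prop :=
  ∀ R : X → X → Prop, ∃ e : X → X, StrictMono e ∧
    ((∀ x y, x < y → R (e x) (e y)) ∨ ∀ x y, x < y → ¬ R (e x) (e y))

variable {X : Type u} [LinearOrder X]

lemma mk_Iic_lt [Infinite X] (hsmall : ∀ x : X, #{y : X | y < x} < #X) (x : X) :
    #(Set.Iic x) < #X := by
  have h : Set.Iic x = insert x {y : X | y < x} := by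
    ext y
    simp [le_iff_eq_or_lt]
  rw [h]
  refine lt_of_le_of_lt (Cardinal.mk_insert_le) ?_
  exact Cardinal.add_lt_of_lt (Cardinal.aleph0_le_mk X) (hsmall x)
    (Cardinal.one_lt_aleph0.trans_le (Cardinal.aleph0_le_mk X))

lemma exists_gt_of_small [Infinite X] (hsmall : ∀ x : X, #{y : X | y < x} < #X) (x : X) :
    ∃ y, x < y := by
  by_contra! h
  have : Set.Iic x = Set.univ := by
    ext y
    simp [h y]
  have h2 := mk_Iic_lt hsmall x
  rw [this, Cardinal.mk_univ] at h2
  exact lt_irrefl _ h2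

lemma exists_strictMono_mem [WellFoundedLT X]
    (hsmall : ∀ x : X, #{y : X | y < x} < #X) {S : Set X} (hS : #S = #X) :
    ∃ e : X → X, StrictMono e ∧ ∀ x, e x ∈ S := by
  have h1 : Ordinal.type (α := X) (· < ·) ≤ (#X).ord := by
    refine le_of_forall_lt fun o ho => ?_
    obtain ⟨x, rfl⟩ := Ordinal.typein_surj (α := X) (· < ·) ho
    rw [Cardinal.lt_ord, Ordinal.card_typein]
    exact hsmall x
  have h2 : (#S).ord ≤ Ordinal.type (α := S) (· < ·) := Cardinal.ord_le_type _
  rw [hS] at h2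
  obtain ⟨g⟩ := Ordinal.type_le_iff'.1 (h1.trans h2)
  exact ⟨fun x => g x, fun x y hxy => g.map_rel_iff.2 hxy, fun x => (g x).2⟩

lemma pairHomogeneous_of_partition [WellFoundedLT X]
    (hsmall : ∀ x : X, #{y : X | y < x} < #X)
    (hpart : ∀ f : X → X → Bool, ∃ A : Set X, #↥A = #X ∧ ∃ b : Bool,
      ∀ x ∈ A, ∀ y ∈ A, x < y → f x y = b) : PairHomogeneous X := by
  classical
  intro R
  obtain ⟨A, hA, b, hb⟩ := hpart fun x y => decide (R x y)
  obtain ⟨e, he, heA⟩ := exists_strictMono_mem hsmall hA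
  refine ⟨e, he, ?_⟩
  cases b with
  | true => exact Or.inl fun x y hxy => by simpa using hb _ (heA x) _ (heA y) (he hxy)
  | false => exact Or.inr fun x y hxy => by simpa using hb _ (heA x) _ (heA y) (he hxy)

/-- Regularity: small families in `X` are bounded. -/
lemma PairHomogeneous.exists_bound [WellFoundedLT X] [Infinite X] (hP : PairHomogeneous X)
    (hsmall : ∀ x : X, #{y : X | y < x} < #X) {J : Type u} (hJ : #J < #X) (t : J → X) :
    ∃ b, ∀ j, t j ≤ b := by
  by_contra! h
  choose g hg using h
  obtain ⟨e, he, h | h⟩ := hP fun x y => g x = g y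
  · obtain ⟨x₀⟩ := (inferInstance : Nonempty X)
    obtain ⟨y, hy⟩ := exists_gt_of_small hsmall (max x₀ (t (g (e x₀))))
    have h1 := h x₀ y ((le_max_left _ _).trans_lt hy)
    have h2 := hg (e y)
    rw [← h1] at h2
    exact absurd ((he.le_apply (x := y)).trans_lt h2)
      (not_lt.2 ((le_max_right _ _).trans hy.le))
  · have hinj : Function.Injective fun x => g (e x) := by
      intro x y hxy
      rcases lt_trichotomy x y with h1 | h1 | h1
      · exact absurd hxy (h _ _ h1)
      · exact h1
      · exact absurd hxy.symm (h _ _ h1)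
    exact absurd (Cardinal.mk_le_of_injective hinj) (not_le.2 hJ)

/-- Given `#X` many subsets of `X`, some strictly increasing self-map of `X` is eventually inside
or eventually outside each of them: it is monotone for the lexicographic order of traces. -/
lemma PairHomogeneous.exists_eventually_const [WellFoundedLT X] [Infinite X]
    (hP : PairHomogeneous X) (hsmall : ∀ x : X, #{y : X | y < x} < #X) (G : X → X → Prop) :
    ∃ e : X → X, StrictMono e ∧ ∀ ξ, ∃ (L : Prop) (b : X), ∀ x, b ≤ x → (G ξ (e x) ↔ L) := by
  obtain ⟨e, he, h⟩ := hP fun x y => ∃ ξ, (∀ η < ξ, (G η x ↔ G η y)) ∧ ¬ G ξ x ∧ G ξ y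
  refine ⟨e, he, fun ξ => ?_⟩
  induction ξ using WellFoundedLT.induction with
  | ind ξ ih =>
    choose! L b hb using ih
    obtain ⟨B, hB⟩ := hP.exists_bound hsmall (hsmall ξ) (fun η => b η.1)
    have agree : ∀ x y, B ≤ x → B ≤ y → ∀ η < ξ, (G η (e x) ↔ G η (e y)) :=
      fun x y hx hy η hη => (hb η hη x ((hB ⟨η, hη⟩).trans hx)).trans
        (hb η hη y ((hB ⟨η, hη⟩).trans hy)).symm
    rcases h with h | h
    · have mono : ∀ x y, B ≤ x → x < y → G ξ (e x) → G ξ (e y) := by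
        intro x y hx hxy hG
        obtain ⟨ζ, h1, h2, h3⟩ := h x y hxy
        rcases lt_trichotomy ζ ξ with hζ | rfl | hζ
        · exact absurd ((agree x y hx (hx.trans hxy.le) ζ hζ).2 h3) h2
        · exact h3
        · exact (h1 ξ hζ).1 hG
      by_cases hex : ∃ x, B ≤ x ∧ G ξ (e x)
      · obtain ⟨x, hx, hG⟩ := hex
        refine ⟨True, x, fun y hy => iff_true_intro ?_⟩
        rcases hy.eq_or_lt with rfl | hy
        · exact hG
        · exact mono x y hx hy hG
      · push Not at hex
        exact ⟨False, B, fun y hy => iff_false_intro (hex y hy)⟩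
    · have anti : ∀ x y, B ≤ x → x < y → G ξ (e y) → G ξ (e x) := by
        intro x y hx hxy hG
        by_contra hn
        exact h x y hxy ⟨ξ, agree x y hx (hx.trans hxy.le), hn, hG⟩
      by_cases hex : ∃ x, B ≤ x ∧ ¬ G ξ (e x)
      · obtain ⟨x, hx, hG⟩ := hex
        refine ⟨False, x, fun y hy => iff_false_intro ?_⟩
        rcases hy.eq_or_lt with rfl | hy
        · exact hG
        · exact fun hGy => hG (anti x y hx hy hGy)
      · push Not at hex
        exact ⟨True, B, fun y hy => iff_true_intro (hex y hy)⟩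

lemma mk_fin_fun_lt {Y Z : Type u} [Infinite Z] (hY : #Y < #Z) (n : ℕ) :
    #(Fin n → Y) < #Z := by
  rcases finite_or_infinite Y with h | h
  · exact (Cardinal.lt_aleph0_of_finite _).trans_le (Cardinal.aleph0_le_mk Z)
  · refine lt_of_le_of_lt ?_ hY
    simpa using Cardinal.power_nat_le (n := n) (Cardinal.aleph0_le_mk Y)

/-- Existence of end-homogeneous maps for colourings of finite increasing tuples. -/
lemma PairHomogeneous.exists_endHomogeneous [WellFoundedLT X] [Infinite X]
    (hP : PairHomogeneous X) (hsmall : ∀ x : X, #{y : X | y < x} < #X) (n : ℕ)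
    (f : (Fin (n + 2) → X) → Prop) :
    ∃ (e : X → X) (h : (Fin (n + 1) → X) → Prop), StrictMono e ∧
      ∀ t : Fin (n + 2) → X, StrictMono t → (f (e ∘ t) ↔ h (Fin.init t)) := by
  have hcard : #(Fin (n + 1) → X) ≤ #X := by
    simpa only [Cardinal.mk_pi, Cardinal.prod_const, Cardinal.mk_fin, Cardinal.lift_natCast,
      Cardinal.lift_id, Cardinal.lift_uzero, Cardinal.power_natCast] using
      Cardinal.power_nat_le (n := n + 1) (Cardinal.aleph0_le_mk X)
  obtain ⟨ψ⟩ := hcard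
  obtain ⟨e₀, he₀, H⟩ := hP.exists_eventually_const hsmall
    fun ξ x => f (Fin.snoc (α := fun _ => X) (Function.invFun ψ ξ) x)
  have H' : ∀ s : Fin (n + 1) → X, ∃ (L : Prop) (b : X), ∀ x, b ≤ x →
      (f (Fin.snoc (α := fun _ => X) s (e₀ x)) ↔ L) := by
    intro s
    have := H (ψ s)
    rwa [Function.leftInverse_invFun ψ.injective s] at this
  choose L b hb using H'
  have hB : ∀ x : X, ∃ B, ∀ s : Fin (n + 1) → Set.Iic x, b (fun i => e₀ (s i)) ≤ B := fun x =>
    hP.exists_bound hsmall (mk_fin_fun_lt (mk_Iic_lt hsmall x) _) _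
  choose B hB using hB
  obtain ⟨e₁, he₁, h⟩ := hP fun x y => B x ≤ y
  have h₁ : ∀ x y, x < y → B (e₁ x) ≤ e₁ y := by
    rcases h with h | h
    · exact h
    · obtain ⟨x₀⟩ := (inferInstance : Nonempty X)
      obtain ⟨y, hy⟩ := exists_gt_of_small hsmall (max x₀ (B (e₁ x₀)))
      exact absurd (((le_max_right _ _).trans hy.le).trans he₁.le_apply)
        (h x₀ y ((le_max_left _ _).trans_lt hy))
  refine ⟨e₀ ∘ e₁, fun s => L (e₀ ∘ e₁ ∘ s), he₀.comp he₁, fun t ht => ?_⟩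
  have key := hb (e₀ ∘ e₁ ∘ Fin.init t) (e₁ (t (Fin.last _))) ?_
  · have hsnoc : Fin.snoc (α := fun _ => X) (e₀ ∘ e₁ ∘ Fin.init t) (e₀ (e₁ (t (Fin.last _))))
        = (e₀ ∘ e₁) ∘ t := by
      funext i
      refine Fin.lastCases ?_ (fun j => ?_) i <;> simp [Fin.init]
    rwa [hsnoc] at key
  · refine (hB (e₁ (t (Fin.last n).castSucc)) fun i => ⟨e₁ (Fin.init t i), ?_⟩).trans
      (h₁ _ _ (ht (Fin.castSucc_lt_last _)))
    exact he₁.monotone (ht.monotone (Fin.castSucc_le_castSucc_iff.2 (Fin.le_last i)))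

lemma PairHomogeneous.exists_homogeneous [WellFoundedLT X] [Infinite X]
    (hP : PairHomogeneous X) (hsmall : ∀ x : X, #{y : X | y < x} < #X) (n : ℕ)
    (f : (Fin (n + 1) → X) → Prop) :
    ∃ e : X → X, StrictMono e ∧
      ∀ s t : Fin (n + 1) → X, StrictMono s → StrictMono t → (f (e ∘ s) ↔ f (e ∘ t)) := by
  induction n with
  | zero =>
    have hconst : ∀ (e : X → X) (s : Fin 1 → X), e ∘ s = fun _ => e (s 0) := by
      intro e s
      funext i
      rw [Subsingleton.elim i 0]
      rfl
    rcases (Cardinal.mk_set_le {x | f fun _ => x}).eq_or_lt with h | h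
    · obtain ⟨e, he, hmem⟩ := exists_strictMono_mem hsmall h
      refine ⟨e, he, fun s t _ _ => ?_⟩
      rw [hconst e s, hconst e t]
      exact iff_of_true (hmem _) (hmem _)
    · obtain ⟨e, he, hmem⟩ :=
        exists_strictMono_mem hsmall (Cardinal.mk_compl_of_infinite _ h)
      refine ⟨e, he, fun s t _ _ => ?_⟩
      rw [hconst e s, hconst e t]
      exact iff_of_false (hmem _) (hmem _)
  | succ n ih =>
    obtain ⟨e₀, h, he₀, h₀⟩ := hP.exists_endHomogeneous hsmall n f
    obtain ⟨e₁, he₁, h₁⟩ := ih h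
    refine ⟨e₀ ∘ e₁, he₀.comp he₁, fun s t hs ht => ?_⟩
    have hinit : ∀ r : Fin (n + 2) → X, StrictMono r → StrictMono (Fin.init r) :=
      fun r hr => hr.comp (Fin.strictMono_castSucc)
    exact (h₀ (e₁ ∘ s) (he₁.comp hs)).trans
      ((h₁ _ _ (hinit s hs) (hinit t ht)).trans (h₀ (e₁ ∘ t) (he₁.comp ht)).symm)

lemma PairHomogeneous.exists_homogeneous_finset [WellFoundedLT X] [Infinite X]
    (hP : PairHomogeneous X) (hsmall : ∀ x : X, #{y : X | y < x} < #X) {ι : Type*}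
    (d : ι → ℕ) (f : ∀ i, (Fin (d i + 1) → X) → Prop) (T : Finset ι) :
    ∃ e : X → X, StrictMono e ∧ ∀ i ∈ T, ∀ s t : Fin (d i + 1) → X,
      StrictMono s → StrictMono t → (f i (e ∘ s) ↔ f i (e ∘ t)) := by
  classical
  induction T using Finset.induction_on with
  | empty => exact ⟨id, strictMono_id, by simp⟩
  | insert i T _ ih =>
    obtain ⟨e₀, he₀, h₀⟩ := ih
    obtain ⟨e₁, he₁, h₁⟩ := hP.exists_homogeneous hsmall (d i) fun s => f i (e₀ ∘ s)
    refine ⟨e₀ ∘ e₁, he₀.comp he₁, fun j hj s t hs ht => ?_⟩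
    rcases Finset.mem_insert.1 hj with rfl | hj
    · exact h₁ s t hs ht
    · exact h₀ j hj _ _ (he₁.comp hs) (he₁.comp ht)

/-- Two finite tuples with the same order pattern factor through strictly increasing tuples by a
common map. -/
lemma exists_strictMono_factor {n : ℕ} {a b : Fin (n + 1) → X}
    (hab : ∀ i j, a i < a j ↔ b i < b j) :
    ∃ (k : Fin (n + 1)) (π : Fin (n + 1) → Fin (k + 1)) (s t : Fin (k + 1) → X),
      StrictMono s ∧ StrictMono t ∧ s ∘ π = a ∧ t ∘ π = b := by
  classical
  have hpos : 0 < (Finset.univ.image a).card := Finset.card_pos.2 (by simp)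
  have hle : (Finset.univ.image a).card ≤ n + 1 := by
    simpa using Finset.card_image_le (s := Finset.univ) (f := a)
  obtain ⟨k, hk⟩ := Nat.exists_eq_succ_of_ne_zero hpos.ne'
  let s := (Finset.univ.image a).orderEmbOfFin hk
  have hrange : Set.range s = Set.range a := by
    simp [s]
  have hπ : ∀ i, ∃ u, s u = a i := fun i => by
    have : a i ∈ Set.range s := hrange ▸ Set.mem_range_self i
    exact this
  have hr : ∀ u, ∃ i, a i = s u := fun u => by
    have : s u ∈ Set.range a := hrange ▸ Set.mem_range_self u
    exact this
  choose π hπ using hπ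
  choose r hr using hr
  refine ⟨⟨k, by omega⟩, π, s, b ∘ r, s.strictMono, fun u v huv => ?_, funext hπ,
    funext fun i => ?_⟩
  · refine (hab _ _).1 ?_
    rw [hr, hr]
    exact s.strictMono huv
  · have h : a (r (π i)) = a i := (hr _).trans (hπ i)
    refine le_antisymm (not_lt.1 fun hlt => ?_) (not_lt.1 fun hlt => ?_)
    · exact ((hab _ _).2 hlt).ne h.symm
    · exact ((hab _ _).2 hlt).ne h

end CanonicalRamsey

theorem stmt19 {X : Type u} [LinearOrder X] [WellFoundedLT X] [Infinite X]
    (hsmall : ∀ x : X, #{y : X | y < x} < #X)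
    (hpart : ∀ f : X → X → Bool, ∃ A : Set X, #↥A = #X ∧ ∃ b : Bool,
      ∀ x ∈ A, ∀ y ∈ A, x < y → f x y = b)
    (F : X → X → X) (S : Set X) (hS : #↥S = #X) :
    ∃ S' ⊆ S, #↥S' = #X ∧ IsCanonicalOn F S' := by
  have hP := pairHomogeneous_of_partition hsmall hpart
  obtain ⟨e₀, he₀, hmem⟩ := exists_strictMono_mem hsmall hS
  obtain ⟨e₁, he₁, h⟩ := hP.exists_homogeneous_finset hsmall
    (ι := Σ k : Fin 4, Fin 4 → Fin (k + 1)) (fun i => i.1)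
    (fun i s => F (e₀ (s (i.2 0))) (e₀ (s (i.2 1))) < F (e₀ (s (i.2 2))) (e₀ (s (i.2 3))))
    Finset.univ
  have he := he₀.comp he₁
  refine ⟨Set.range (e₀ ∘ e₁), ?_, Cardinal.mk_range_eq _ he.injective, ?_⟩
  · rintro _ ⟨x, rfl⟩
    exact hmem _
  · intro a b ha hb hab _ _ hF
    choose a' ha' using ha
    choose b' hb' using hb
    obtain rfl : (e₀ ∘ e₁) ∘ a' = a := funext ha'
    obtain rfl : (e₀ ∘ e₁) ∘ b' = b := funext hb'
    obtain ⟨k, π, s, t, hs, ht, rfl, rfl⟩ := exists_strictMono_factor (a := a') (b := b')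
      fun i j => by simpa only [Function.comp_apply, he₀.lt_iff_lt, he₁.lt_iff_lt] using hab i j
    exact (h ⟨k, π⟩ (Finset.mem_univ _) s t hs ht).1 hF
end
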